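/- Suppose W is finite. Let θ : W → W be a group automorphism mapping S onto itself, and let 𝒦 ⊆ W be a quasiparabolic θ-twisted conjugacy class. Then θ ∘ θ = id and θ(x) = x⁻¹ for every x ∈ 𝒦; that is, in a finite Coxeter group every quasiparabolic twisted conjugacy class consists of twisted involutions. -/

import Mathlib

noncomputable section

variable {B W : Type*} [Group W] {M : CoxeterMatrix B}

/-- The `θ`-twisted conjugation action of `W` on itself: `w • x = w·x·θ(w)⁻¹`. -/
def twConj (θ : W ≃* W) (w x : W) : W := w * x * (θ w)⁻¹

/-- The height function `ht = ℓ/2` on `W`. -/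
def htL (cs : CoxeterSystem M W) (x : W) : ℚ := (cs.length x : ℚ) / 2

/-- `𝒦` is a `θ`-twisted conjugacy class, i.e. an orbit of the twisted conjugation action. -/
def IsTwClass (θ : W ≃* W) (𝒦 : Set W) : Prop :=
  ∃ x₀ : W, 𝒦 = Set.range fun w => twConj θ w x₀

/-- The `θ`-twisted conjugacy class `𝒦` is quasiparabolic with respect to the height
function `ht = ℓ/2`: (QP1) and (QP2) hold. -/
def IsQPClass (cs : CoxeterSystem M W) (θ : W ≃* W) (𝒦 : Set W) : Prop :=
  (∀ r : W, cs.IsReflection r → ∀ x ∈ 𝒦,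
      htL cs (twConj θ r x) = htL cs x → twConj θ r x = x) ∧
  (∀ r : W, cs.IsReflection r → ∀ x ∈ 𝒦, ∀ i : B,
      htL cs x < htL cs (twConj θ r x) →
      htL cs (twConj θ (cs.simple i) (twConj θ r x)) < htL cs (twConj θ (cs.simple i) x) →
      twConj θ r x = twConj θ (cs.simple i) x)

/-- `x` is a `W`-minimal element: `ℓ(s·x·θ(s)⁻¹) ≥ ℓ(x)` for all simple reflections `s`. -/
def TwMin (cs : CoxeterSystem M W) (θ : W ≃* W) (x : W) : Prop :=
  ∀ i : B, cs.length x ≤ cs.length (twConj θ (cs.simple i) x)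

/-- The automorphism `θ` maps the set `S` of simple reflections onto itself. -/
def SimpleOnto (cs : CoxeterSystem M W) (θ : W ≃* W) : Prop :=
  ⇑θ '' Set.range cs.simple = Set.range cs.simple

/-! ### Quasiparabolic heights and minimal elements -/

/-- The quasiparabolic axioms for `𝒦` with respect to an arbitrary height function. -/
def IsQPHeight (cs : CoxeterSystem M W) (θ : W ≃* W) (h : W → ℚ) (𝒦 : Set W) : Prop :=
  (∀ r : W, cs.IsReflection r → ∀ x ∈ 𝒦, h (twConj θ r x) = h x → twConj θ r x = x) ∧
  (∀ r : W, cs.IsReflection r → ∀ x ∈ 𝒦, ∀ i : B, h x < h (twConj θ r x) →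
      h (twConj θ (cs.simple i) (twConj θ r x)) < h (twConj θ (cs.simple i) x) →
      twConj θ r x = twConj θ (cs.simple i) x)

theorem twConj_one (θ : W ≃* W) (x : W) : twConj θ 1 x = x := by simp [twConj]

theorem twConj_mul (θ : W ≃* W) (a b x : W) :
    twConj θ (a * b) x = twConj θ a (twConj θ b x) := by simp [twConj, mul_assoc]

theorem twConj_inv_twConj (θ : W ≃* W) (a x : W) : twConj θ a⁻¹ (twConj θ a x) = x := by
  rw [← twConj_mul, inv_mul_cancel, twConj_one]

theorem twConj_twConj_inv (θ : W ≃* W) (a x : W) : twConj θ a (twConj θ a⁻¹ x) = x := by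
  rw [← twConj_mul, mul_inv_cancel, twConj_one]

theorem twConj_simple_simple (cs : CoxeterSystem M W) (θ : W ≃* W) (i : B) (x : W) :
    twConj θ (cs.simple i) (twConj θ (cs.simple i) x) = x := by
  rw [← twConj_mul, cs.simple_mul_simple_self, twConj_one]

theorem IsTwClass.twConj_mem {θ : W ≃* W} {𝒦 : Set W} (hK : IsTwClass θ 𝒦) (w : W) {x : W}
    (hx : x ∈ 𝒦) : twConj θ w x ∈ 𝒦 := by
  obtain ⟨x₀, rfl⟩ := hK
  obtain ⟨a, rfl⟩ := hx
  exact ⟨w * a, twConj_mul θ w a x₀⟩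

theorem IsTwClass.exists_twConj {θ : W ≃* W} {𝒦 : Set W} (hK : IsTwClass θ 𝒦) {x y : W}
    (hx : x ∈ 𝒦) (hy : y ∈ 𝒦) : ∃ w, y = twConj θ w x := by
  obtain ⟨x₀, rfl⟩ := hK
  obtain ⟨a, rfl⟩ := hx
  obtain ⟨b, rfl⟩ := hy
  refine ⟨b * a⁻¹, ?_⟩
  simp only [twConj_mul, twConj_inv_twConj]

/-- The quasiparabolic axioms are invariant under reversing the height. -/
theorem IsQPHeight.neg {cs : CoxeterSystem M W} {θ : W ≃* W} {h : W → ℚ} {𝒦 : Set W}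
    (hK : IsTwClass θ 𝒦) (hqp : IsQPHeight cs θ h 𝒦) : IsQPHeight cs θ (fun x => -h x) 𝒦 := by
  refine ⟨fun r hr x hx hh => hqp.1 r hr x hx (neg_injective hh), fun r hr x hx i h1 h2 => ?_⟩
  have key : ∀ y, twConj θ (cs.simple i * r * (cs.simple i)⁻¹) (twConj θ (cs.simple i) y) =
      twConj θ (cs.simple i) (twConj θ r y) := fun y => by
    rw [← twConj_mul, ← twConj_mul, inv_mul_cancel_right]
  have := hqp.2 _ (hr.conj (cs.simple i)) _ (hK.twConj_mem (cs.simple i) hx) i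
    (by rw [key]; exact neg_lt_neg_iff.1 h2)
    (by rw [key, twConj_simple_simple, twConj_simple_simple]; exact neg_lt_neg_iff.1 h1)
  rw [key, twConj_simple_simple] at this
  rw [← this, twConj_simple_simple, this]

/-- The strong exchange property of quasiparabolic sets. -/
theorem IsQPHeight.exchange {cs : CoxeterSystem M W} {θ : W ≃* W} {h : W → ℚ} {𝒦 : Set W}
    (hK : IsTwClass θ 𝒦) (hqp : IsQPHeight cs θ h 𝒦) {r x : W} (hr : cs.IsReflection r)
    (hx : x ∈ 𝒦) (hup : h x < h (twConj θ r x)) (ω : List B)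
    (hdown : h (twConj θ (cs.wordProd ω) (twConj θ r x)) < h (twConj θ (cs.wordProd ω) x)) :
    ∃ u, cs.length u < ω.length ∧ twConj θ (cs.wordProd ω) (twConj θ r x) = twConj θ u x := by
  induction ω with
  | nil =>
    simp only [cs.wordProd_nil, twConj_one] at hdown
    exact absurd hup hdown.not_gt
  | cons i ω ih =>
    simp only [cs.wordProd_cons, twConj_mul, List.length_cons] at hdown ⊢
    rcases lt_or_ge (h (twConj θ (cs.wordProd ω) (twConj θ r x)))
      (h (twConj θ (cs.wordProd ω) x)) with hlt | hge
    · obtain ⟨u, hu, hux⟩ := ih hlt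
      refine ⟨cs.simple i * u, ?_, by rw [hux, twConj_mul]⟩
      have := cs.length_mul_le (cs.simple i) u
      rw [cs.length_simple] at this
      omega
    · have key : twConj θ (cs.wordProd ω * r * (cs.wordProd ω)⁻¹) (twConj θ (cs.wordProd ω) x) =
          twConj θ (cs.wordProd ω) (twConj θ r x) := by
        rw [← twConj_mul, ← twConj_mul, inv_mul_cancel_right]
      have hx' := hK.twConj_mem (cs.wordProd ω) hx
      have hr' := hr.conj (cs.wordProd ω)
      rw [← key] at hge hdown ⊢
      rcases hge.eq_or_lt with heq | hlt
      · have := hqp.1 _ hr' _ hx' heq.symm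
        rw [this] at hdown
        exact absurd hdown (lt_irrefl _)
      · refine ⟨cs.wordProd ω, ?_, ?_⟩
        · have := cs.length_wordProd_le ω
          omega
        · rw [hqp.2 _ hr' _ hx' i hlt hdown, twConj_simple_simple]

/-- A locally minimal element of a quasiparabolic class is the global minimum. -/
theorem IsQPHeight.eq_of_locally_minimal {cs : CoxeterSystem M W} {θ : W ≃* W} {h : W → ℚ}
    {𝒦 : Set W} (hK : IsTwClass θ 𝒦) (hqp : IsQPHeight cs θ h 𝒦) {x y : W} (hx : x ∈ 𝒦)
    (hy : y ∈ 𝒦) (hxmin : ∀ i, h x ≤ h (twConj θ (cs.simple i) x)) (hymin : ∀ z ∈ 𝒦, h y ≤ h z) :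
    x = y := by
  classical
  have hex : ∃ n w, x = twConj θ w y ∧ cs.length w = n := by
    obtain ⟨w, hw⟩ := hK.exists_twConj hy hx
    exact ⟨_, w, hw, rfl⟩
  obtain ⟨w, hw, hlen⟩ := Nat.find_spec hex
  have hmin : ∀ u, x = twConj θ u y → cs.length w ≤ cs.length u := fun u hu => by
    rw [hlen]
    exact Nat.find_min' hex ⟨u, hu, rfl⟩
  by_cases hw1 : w = 1
  · rw [hw, hw1, twConj_one]
  obtain ⟨i, hi⟩ := cs.exists_leftDescent_of_ne_one hw1
  obtain ⟨ω, hω, hωw⟩ := cs.exists_isReduced (cs.simple i * w)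
  have hi' : cs.length (cs.simple i * w) < cs.length w := hi
  have hsx : twConj θ (cs.simple i) x = twConj θ (cs.simple i * w) y := by rw [twConj_mul, ← hw]
  have hne : h x ≠ h (twConj θ (cs.simple i) x) := fun heq => by
    have h1 := hqp.1 _ (cs.isReflection_simple i) x hx heq.symm
    rw [hsx] at h1
    exact absurd (hmin _ h1.symm) (not_le.2 hi')
  have hlt := lt_of_le_of_ne (hxmin i) hne
  set v := cs.simple i * w with hv
  have hr : cs.IsReflection (v⁻¹ * cs.simple i * v) := by
    simpa using (cs.isReflection_simple i).conj v⁻¹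
  have hvr : twConj θ v (twConj θ (v⁻¹ * cs.simple i * v) y) = x := by
    rw [← twConj_mul, mul_assoc v⁻¹, mul_inv_cancel_left, hv, cs.simple_mul_simple_cancel_left, ← hw]
  rw [hsx, ← hvr] at hlt
  rcases (hymin _ (hK.twConj_mem (v⁻¹ * cs.simple i * v) hy)).eq_or_lt with heq | hup
  · rw [hqp.1 _ hr y hy heq.symm] at hlt
    exact absurd hlt (lt_irrefl _)
  · rw [hωw] at hlt hvr hr hup
    obtain ⟨u, hu, hux⟩ := hqp.exchange hK hr hy hup ω hlt
    have h1 := hmin u (by rw [← hux, hvr])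
    rw [← hω.eq, ← hωw] at hu
    omega

/-! ### The geometric representation -/

open Polynomial.Chebyshev in
/-- The product of two reflections at angle `π / m` has order dividing `m`. -/
theorem reflection_mul_reflection_pow_eq_one {V : Type*} [AddCommGroup V] [Module ℝ V] {x y : V}
    {f g : Module.Dual ℝ V} (hf : f x = 2) (hg : g y = 2) {m : ℕ} (hm : 2 ≤ m)
    (hfy : f y = -2 * Real.cos (Real.pi / m)) (hgx : g x = -2 * Real.cos (Real.pi / m)) :
    (Module.reflection hf * Module.reflection hg) ^ m = 1 := by
  ext z
  rcases hm.eq_or_lt with rfl | hm3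
  · have h0 : Real.cos (Real.pi / (2 : ℕ)) = 0 := by simp
    rw [h0, mul_zero] at hfy hgx
    simp only [pow_two, LinearEquiv.mul_apply, Module.reflection_apply, map_sub, map_smul, hf, hg,
      hfy, hgx, LinearEquiv.coe_one, id]
    module
  have hm0 : (0 : ℝ) < m := by positivity
  have hm3' : (3 : ℝ) ≤ m := by exact_mod_cast hm3
  set φ := 2 * Real.pi / m with hφ
  have hφm : (m : ℝ) * φ = 2 * Real.pi := by rw [hφ]; field_simp
  have ht : 2 * Real.cos φ = f y * g x - 2 := by
    rw [hfy, hgx, hφ, mul_div_assoc, Real.cos_two_mul]; ring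
  have hsin : Real.sin φ ≠ 0 := by
    refine (Real.sin_pos_of_pos_of_lt_pi (by positivity) ?_).ne'
    rw [hφ, div_lt_iff₀ hm0]
    nlinarith [Real.pi_pos]
  rw [Module.reflection_mul_reflection_pow_apply hf hg m z _ ht]
  have hS := S_two_mul_real_cos φ
  rcases Nat.even_or_odd' m with ⟨k, rfl | rfl⟩
  · have e1 : (((2 * k : ℕ) : ℤ) - 2) / 2 = k - 1 := by omega
    have e2 : (((2 * k : ℕ) : ℤ) - 1) / 2 = k - 1 := by omega
    have h0 : (S ℝ ((k : ℤ) - 1)).eval (2 * Real.cos φ) = 0 := by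
      refine (mul_eq_zero.1 ((hS _).trans ?_)).resolve_right hsin
      have : (k : ℝ) * φ = Real.pi := by push_cast at hφm; linarith
      push_cast
      rw [sub_add_cancel, this, Real.sin_pi]
    rw [e1, e2, h0]
    simp
  · have e1 : (((2 * k + 1 : ℕ) : ℤ) - 2) / 2 = k - 1 := by omega
    have e2 : (((2 * k + 1 : ℕ) : ℤ) - 1) / 2 = k := by omega
    have e3 : (((2 * k + 1 : ℕ) : ℤ) - 3) / 2 = k - 1 := by omega
    have e4 : (((2 * k + 1 : ℕ) : ℤ)) / 2 = k := by omega
    have h0 : (S ℝ (k : ℤ)).eval (2 * Real.cos φ) + (S ℝ ((k : ℤ) - 1)).eval (2 * Real.cos φ)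
        = 0 := by
      refine (mul_eq_zero.1 ?_).resolve_right hsin
      rw [add_mul, hS, hS]
      have : ((k : ℝ) + 1) * φ = 2 * Real.pi - k * φ := by push_cast at hφm; linarith
      push_cast
      rw [sub_add_cancel, this, Real.sin_two_pi_sub, neg_add_cancel]
    rw [e1, e2, e3, e4, h0]
    simp

/-- The simple coroot attached to `s`, as a functional on the root space of `S ⊆ W`. -/
def coroot (S : Set W) (s : S) : Module.Dual ℝ (S →₀ ℝ) :=
  Finsupp.linearCombination ℝ fun t : S => -2 * Real.cos (Real.pi / orderOf ((s : W) * t))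

/-- The simple root attached to `s`. -/
abbrev sroot (S : Set W) (s : S) : S →₀ ℝ := Finsupp.single s 1

theorem coroot_sroot (S : Set W) (s t : S) :
    coroot S s (sroot S t) = -2 * Real.cos (Real.pi / orderOf ((s : W) * t)) := by
  simp [coroot]

theorem coroot_sroot_self {S : Set W} {s : S} (hs : (s : W) * s = 1) :
    coroot S s (sroot S s) = 2 := by
  simp [coroot_sroot, hs]

/-- A simple reflection, as an element of `S`. -/
def sgen (cs : CoxeterSystem M W) (i : B) : Set.range cs.simple := ⟨cs.simple i, i, rfl⟩

theorem coroot_sgen_self (cs : CoxeterSystem M W) (i : B) :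
    coroot (Set.range cs.simple) (sgen cs i) (sroot _ (sgen cs i)) = 2 :=
  coroot_sroot_self (cs.simple_mul_simple_self i)

theorem two_le_orderOf_simple_mul [Finite W] (cs : CoxeterSystem M W) {i j : B}
    (h : sgen cs i ≠ sgen cs j) : 2 ≤ orderOf (cs.simple i * cs.simple j) := by
  have h1 : orderOf (cs.simple i * cs.simple j) ≠ 1 := fun h1 => by
    rw [orderOf_eq_one_iff, mul_eq_one_iff_eq_inv, cs.inv_simple] at h1
    exact h (Subtype.ext h1)
  have := orderOf_pos (cs.simple i * cs.simple j)
  omega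

theorem isLiftable_preReflection [Finite W] (cs : CoxeterSystem M W) :
    M.IsLiftable fun i => Module.preReflection (sroot _ (sgen cs i))
      (coroot (Set.range cs.simple) (sgen cs i)) := by
  intro i j
  obtain ⟨k, hk⟩ := orderOf_dvd_of_pow_eq_one (cs.simple_mul_simple_pow i j)
  suffices h : (Module.reflection (coroot_sgen_self cs i) *
      Module.reflection (coroot_sgen_self cs j)) ^ orderOf (cs.simple i * cs.simple j) = 1 by
    rw [hk, pow_mul]
    have h2 := congrArg (LinearEquiv.automorphismGroup.toLinearMapMonoidHom) h
    simp only [map_pow, map_mul, map_one] at h2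
    exact (congrArg (· ^ k) h2).trans (one_pow k)
  by_cases hij : sgen cs i = sgen cs j
  · have h1 : cs.simple i = cs.simple j := congrArg Subtype.val hij
    rw [h1, cs.simple_mul_simple_self, orderOf_one, pow_one]
    ext1 z
    simp only [hij, LinearEquiv.mul_apply, LinearEquiv.coe_one, id]
    exact Module.involutive_reflection (coroot_sgen_self cs j) z
  · refine reflection_mul_reflection_pow_eq_one _ _ (two_le_orderOf_simple_mul cs hij) ?_ ?_
    · exact coroot_sroot _ _ _
    · rw [coroot_sroot, ← orderOf_inv]
      simp [sgen]

/-- The geometric representation of a finite Coxeter group. -/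
def geomRep [Finite W] (cs : CoxeterSystem M W) :
    W →* Module.End ℝ (Set.range cs.simple →₀ ℝ) :=
  cs.lift ⟨_, isLiftable_preReflection cs⟩

theorem geomRep_simple_apply [Finite W] (cs : CoxeterSystem M W) (i : B)
    (y : Set.range cs.simple →₀ ℝ) :
    geomRep cs (cs.simple i) y = y - coroot _ (sgen cs i) y • sroot _ (sgen cs i) := by
  rw [geomRep, cs.lift_apply_simple, Module.preReflection_apply]

theorem geomRep_mul_apply [Finite W] (cs : CoxeterSystem M W) (a b : W)
    (y : Set.range cs.simple →₀ ℝ) : geomRep cs (a * b) y = geomRep cs a (geomRep cs b y) := by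
  rw [map_mul, Module.End.mul_apply]

theorem geomRep_one_apply [Finite W] (cs : CoxeterSystem M W)
    (y : Set.range cs.simple →₀ ℝ) : geomRep cs 1 y = y := by
  rw [map_one, Module.End.one_apply]

theorem geomRep_simple_sroot [Finite W] (cs : CoxeterSystem M W) (i : B) :
    geomRep cs (cs.simple i) (sroot _ (sgen cs i)) = -sroot _ (sgen cs i) := by
  rw [geomRep_simple_apply, coroot_sgen_self]
  module

/-- The coefficients `sin (kπ/m) / sin (π/m)` of the roots of a dihedral group. -/
def dihedralCoeff (m k : ℕ) : ℝ := Real.sin (k * (Real.pi / m)) / Real.sin (Real.pi / m)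

theorem sin_pi_div_pos {m : ℕ} (hm : 2 ≤ m) : 0 < Real.sin (Real.pi / m) := by
  refine Real.sin_pos_of_pos_of_lt_pi (by positivity) (div_lt_self Real.pi_pos ?_)
  exact_mod_cast hm

theorem dihedralCoeff_nonneg {m k : ℕ} (hm : 2 ≤ m) (hk : k ≤ m) : 0 ≤ dihedralCoeff m k := by
  refine div_nonneg (Real.sin_nonneg_of_nonneg_of_le_pi (by positivity) ?_) (sin_pi_div_pos hm).le
  have hk' : (k : ℝ) ≤ m := by exact_mod_cast hk
  have hm0 : (0 : ℝ) < m := by positivity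
  rw [mul_div_left_comm]
  exact mul_le_of_le_one_right Real.pi_pos.le ((div_le_one hm0).2 hk')

theorem dihedralCoeff_zero (m : ℕ) : dihedralCoeff m 0 = 0 := by simp [dihedralCoeff]

theorem dihedralCoeff_one {m : ℕ} (hm : 2 ≤ m) : dihedralCoeff m 1 = 1 := by
  simp [dihedralCoeff, (sin_pi_div_pos hm).ne']

theorem dihedralCoeff_add_two (m k : ℕ) : dihedralCoeff m (k + 2) =
    2 * Real.cos (Real.pi / m) * dihedralCoeff m (k + 1) - dihedralCoeff m k := by
  unfold dihedralCoeff
  generalize Real.pi / m = a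
  push_cast
  have h1 : ((k : ℝ) + 2) * a = (k + 1) * a + a := by ring
  have h2 : (k : ℝ) * a = (k + 1) * a - a := by ring
  rw [h1, h2, Real.sin_add, Real.sin_sub]
  ring

theorem geomRep_simple_sroot_of_ne [Finite W] (cs : CoxeterSystem M W) (i j : B) :
    geomRep cs (cs.simple i) (sroot _ (sgen cs j)) = sroot _ (sgen cs j) +
      (2 * Real.cos (Real.pi / orderOf (cs.simple i * cs.simple j))) • sroot _ (sgen cs i) := by
  rw [geomRep_simple_apply, coroot_sroot]
  simp only [sgen]
  module

theorem orderOf_simple_mul_comm (cs : CoxeterSystem M W) (i j : B) :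
    orderOf (cs.simple j * cs.simple i) = orderOf (cs.simple i * cs.simple j) := by
  rw [← orderOf_inv]; simp

theorem geomRep_alternatingWord [Finite W] (cs : CoxeterSystem M W) {i j : B}
    (hij : sgen cs i ≠ sgen cs j) (k : ℕ) :
    geomRep cs (cs.wordProd (CoxeterSystem.alternatingWord i j k)) (sroot _ (sgen cs i)) =
      dihedralCoeff (orderOf (cs.simple i * cs.simple j)) (k + 1) •
        sroot _ (sgen cs (if Even k then i else j)) +
      dihedralCoeff (orderOf (cs.simple i * cs.simple j)) k •
        sroot _ (sgen cs (if Even k then j else i)) := by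
  have hm := two_le_orderOf_simple_mul cs hij
  induction k with
  | zero =>
    simp only [CoxeterSystem.alternatingWord, cs.wordProd_nil, geomRep_one_apply, zero_add,
      dihedralCoeff_zero, dihedralCoeff_one hm]
    simp
  | succ k ih =>
    rw [CoxeterSystem.alternatingWord_succ', cs.wordProd_cons, geomRep_mul_apply, ih,
      dihedralCoeff_add_two]
    rcases Nat.even_or_odd k with hk | hk
    · simp only [hk, if_true, map_add, map_smul, geomRep_simple_sroot,
        geomRep_simple_sroot_of_ne cs j i, orderOf_simple_mul_comm cs i j,
        Nat.even_add_one, not_true_eq_false, if_false]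
      module
    · have hk' := Nat.not_even_iff_odd.2 hk
      simp only [hk', if_false, map_add, map_smul, geomRep_simple_sroot,
        geomRep_simple_sroot_of_ne cs i j, Nat.even_add_one, not_false_eq_true, if_true]
      module

theorem wordProd_alternatingWord_orderOf (cs : CoxeterSystem M W) (i j : B) :
    cs.wordProd (CoxeterSystem.alternatingWord i j (orderOf (cs.simple i * cs.simple j))) =
      cs.wordProd (CoxeterSystem.alternatingWord j i (orderOf (cs.simple i * cs.simple j))) := by
  have hinv : cs.simple j * cs.simple i = (cs.simple i * cs.simple j)⁻¹ := by simp
  have hpow := pow_orderOf_eq_one (cs.simple i * cs.simple j)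
  rw [cs.prod_alternatingWord_eq_mul_pow, cs.prod_alternatingWord_eq_mul_pow, hinv]
  generalize orderOf (cs.simple i * cs.simple j) = m at hpow
  rcases Nat.even_or_odd' m with ⟨k, rfl | rfl⟩
  · have h2 : 2 * k / 2 = k := by omega
    rw [if_pos (even_two_mul k), if_pos (even_two_mul k), h2, one_mul, one_mul, inv_pow,
      eq_inv_iff_mul_eq_one, ← pow_add, ← two_mul, hpow]
  · have h2 : (2 * k + 1) / 2 = k := by omega
    have hne : ¬Even (2 * k + 1) := by simp
    rw [if_neg hne, if_neg hne, h2, inv_pow, eq_mul_inv_iff_mul_eq, mul_assoc, ← pow_add,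
      ← two_mul]
    have : (cs.simple i * cs.simple j) ^ (2 * k) = (cs.simple i * cs.simple j)⁻¹ := by
      rw [eq_inv_iff_mul_eq_one, ← pow_succ, hpow]
    rw [this]
    simp

theorem length_wordProd_alternatingWord_le (cs : CoxeterSystem M W) (i j : B) (k : ℕ) :
    cs.length (cs.wordProd (CoxeterSystem.alternatingWord i j k)) ≤ k := by
  simpa using cs.length_wordProd_le (CoxeterSystem.alternatingWord i j k)

/-- If `ℓ(w) < ℓ(ws)` then `w` maps the simple root of `s` to a positive root. -/
theorem geomRep_sroot_nonneg [Finite W] (cs : CoxeterSystem M W) (w : W) (i : B)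
    (h : cs.length w < cs.length (w * cs.simple i)) :
    0 ≤ geomRep cs w (sroot _ (sgen cs i)) := by
  induction hn : cs.length w using Nat.strong_induction_on generalizing w i with
  | _ n ih =>
  subst hn
  by_cases hw1 : w = 1
  · rw [hw1, geomRep_one_apply]
    exact Finsupp.single_nonneg.2 zero_le_one
  obtain ⟨j, hj⟩ := cs.exists_rightDescent_of_ne_one hw1
  have hij : sgen cs i ≠ sgen cs j := fun hij => by
    have h1 : cs.simple i = cs.simple j := congrArg Subtype.val hij
    rw [h1] at h
    exact lt_asymm h hj
  set m := orderOf (cs.simple i * cs.simple j) with hm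
  have hm2 : 2 ≤ m := two_le_orderOf_simple_mul cs hij
  let P : ℕ → Prop := fun k => ∃ v, w = v * cs.wordProd (CoxeterSystem.alternatingWord i j k) ∧
    cs.length w = cs.length v + k
  have hP1 : P 1 := by
    refine ⟨w * cs.simple j, ?_, ?_⟩
    · simp [CoxeterSystem.alternatingWord]
    · exact ((cs.isRightDescent_iff).1 hj).symm
  have hPm : ¬P m := by
    rintro ⟨v, hv, hl⟩
    obtain ⟨m', hm'⟩ : ∃ m', m = m' + 1 := ⟨m - 1, by omega⟩
    have hw' : w * cs.simple i = v * cs.wordProd (CoxeterSystem.alternatingWord i j m') := by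
      rw [hv, hm, wordProd_alternatingWord_orderOf, ← hm, hm',
        CoxeterSystem.alternatingWord_succ, cs.wordProd_concat, mul_assoc, mul_assoc,
        cs.simple_mul_simple_self, mul_one]
    have h1 := cs.length_mul_le v (cs.wordProd (CoxeterSystem.alternatingWord i j m'))
    have h2 := length_wordProd_alternatingWord_le cs i j m'
    rw [hw'] at h
    omega
  obtain ⟨k, hk1, hkm, ⟨v, hv, hl⟩, hPk⟩ : ∃ k, 1 ≤ k ∧ k < m ∧ P k ∧ ¬P (k + 1) := by
    by_contra! hcon
    have : ∀ k, 1 ≤ k → k ≤ m → P k := fun k hk => by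
      induction k, hk using Nat.le_induction with
      | base => exact fun _ => hP1
      | succ k hk ih => exact fun hkm => hcon k hk (by omega) (ih (by omega))
    exact hPm (this m (by omega) le_rfl)
  have hnext : cs.length v < cs.length (v * cs.simple (if Even k then j else i)) := by
    by_contra! hle
    refine hPk ⟨v * cs.simple (if Even k then j else i), ?_, ?_⟩
    · rw [CoxeterSystem.alternatingWord_succ', cs.wordProd_cons, mul_assoc,
        cs.simple_mul_simple_cancel_left, hv]
    · rcases cs.length_mul_simple v (if Even k then j else i) with h1 | h1 <;> omega
  have hfirst : cs.length v < cs.length (v * cs.simple (if Even k then i else j)) := by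
    by_contra! hle
    obtain ⟨k', rfl⟩ : ∃ k', k = k' + 1 := ⟨k - 1, by omega⟩
    have hif : (if Even (k' + 1) then i else j) = if Even k' then j else i := by
      by_cases hk' : Even k' <;> simp [hk', Nat.even_add_one]
    rw [hif] at hle
    rw [CoxeterSystem.alternatingWord_succ', cs.wordProd_cons, ← mul_assoc] at hv
    have h1 := cs.length_mul_le (v * cs.simple (if Even k' then j else i))
      (cs.wordProd (CoxeterSystem.alternatingWord i j k'))
    rw [← hv] at h1
    have h2 := length_wordProd_alternatingWord_le cs i j k'
    omega
  rw [hv, geomRep_mul_apply, geomRep_alternatingWord cs hij, map_add, map_smul, map_smul, ← hm]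
  exact add_nonneg
    (smul_nonneg (dihedralCoeff_nonneg hm2 hkm) (ih _ (by omega) _ _ hfirst rfl))
    (smul_nonneg (dihedralCoeff_nonneg hm2 hkm.le) (ih _ (by omega) _ _ hnext rfl))

/-- If `ℓ(ws) < ℓ(w)` then `w` maps the simple root of `s` to a negative root. -/
theorem geomRep_sroot_nonpos [Finite W] (cs : CoxeterSystem M W) (w : W) (i : B)
    (h : cs.length (w * cs.simple i) < cs.length w) :
    geomRep cs w (sroot _ (sgen cs i)) ≤ 0 := by
  have h1 := geomRep_sroot_nonneg cs (w * cs.simple i) i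
    (by rwa [cs.simple_mul_simple_cancel_right])
  rwa [geomRep_mul_apply, geomRep_simple_sroot, map_neg, neg_nonneg] at h1

/-! ### Dominant functionals -/

/-- A functional on the root space is dominant if it is nonnegative on simple roots. -/
def IsDominant (cs : CoxeterSystem M W) (v : Module.Dual ℝ (Set.range cs.simple →₀ ℝ)) : Prop :=
  ∀ i, 0 ≤ v (sroot _ (sgen cs i))

theorem exists_sgen_eq {cs : CoxeterSystem M W} (s : Set.range cs.simple) :
    ∃ i, sgen cs i = s := by
  obtain ⟨_, i, rfl⟩ := s
  exact ⟨i, rfl⟩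

theorem IsDominant.apply_nonneg {cs : CoxeterSystem M W}
    {v : Module.Dual ℝ (Set.range cs.simple →₀ ℝ)} (hv : IsDominant cs v)
    {y : Set.range cs.simple →₀ ℝ} (hy : 0 ≤ y) : 0 ≤ v y := by
  rw [← y.sum_single, map_finsuppSum]
  refine Finset.sum_nonneg fun s _ => ?_
  obtain ⟨i, hi⟩ := exists_sgen_eq s
  have h : Finsupp.single s (y s) = y s • sroot _ s := by simp
  change 0 ≤ v (Finsupp.single s (y s))
  rw [h, map_smul, smul_eq_mul]
  exact mul_nonneg (hy s) (hi ▸ hv i)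

theorem IsDominant.apply_nonpos {cs : CoxeterSystem M W}
    {v : Module.Dual ℝ (Set.range cs.simple →₀ ℝ)} (hv : IsDominant cs v)
    {y : Set.range cs.simple →₀ ℝ} (hy : y ≤ 0) : v y ≤ 0 := by
  have := hv.apply_nonneg (neg_nonneg.2 hy)
  rwa [map_neg, neg_nonneg] at this

theorem comp_geomRep_mul [Finite W] (cs : CoxeterSystem M W)
    (v : Module.Dual ℝ (Set.range cs.simple →₀ ℝ)) (a b : W) :
    v ∘ₗ geomRep cs (a * b) = (v ∘ₗ geomRep cs a) ∘ₗ geomRep cs b := by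
  ext1 s
  ext
  simp [map_mul]

theorem comp_geomRep_one [Finite W] (cs : CoxeterSystem M W)
    (v : Module.Dual ℝ (Set.range cs.simple →₀ ℝ)) : v ∘ₗ geomRep cs 1 = v := by
  rw [map_one]; rfl

theorem comp_geomRep_simple [Finite W] (cs : CoxeterSystem M W)
    (v : Module.Dual ℝ (Set.range cs.simple →₀ ℝ)) (i : B) :
    v ∘ₗ geomRep cs (cs.simple i) = v - v (sroot _ (sgen cs i)) • coroot _ (sgen cs i) := by
  refine LinearMap.ext fun y => ?_
  rw [LinearMap.comp_apply, geomRep_simple_apply, map_sub, map_smul, LinearMap.sub_apply,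
    LinearMap.smul_apply, smul_eq_mul, smul_eq_mul, mul_comm]

/-- Two dominant functionals in the same orbit are equal. -/
theorem IsDominant.comp_geomRep_eq [Finite W] {cs : CoxeterSystem M W}
    {v : Module.Dual ℝ (Set.range cs.simple →₀ ℝ)} (hv : IsDominant cs v) {w : W}
    (hw : IsDominant cs (v ∘ₗ geomRep cs w)) : v ∘ₗ geomRep cs w = v := by
  induction hn : cs.length w using Nat.strong_induction_on generalizing w with
  | _ n ih =>
  subst hn
  by_cases hw1 : w = 1
  · rw [hw1, comp_geomRep_one]
  obtain ⟨i, hi⟩ := cs.exists_rightDescent_of_ne_one hw1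
  have h0 : (v ∘ₗ geomRep cs w) (sroot _ (sgen cs i)) = 0 :=
    le_antisymm (hv.apply_nonpos (geomRep_sroot_nonpos cs w i hi)) (hw i)
  have h1 : v ∘ₗ geomRep cs (w * cs.simple i) = v ∘ₗ geomRep cs w := by
    rw [comp_geomRep_mul, comp_geomRep_simple, h0, zero_smul, sub_zero]
  rw [← h1]
  exact ih _ hi (by rwa [h1]) rfl

/-- An invariant inner product on functionals. -/
def dualPairing [Finite W] (cs : CoxeterSystem M W)
    (f g : Module.Dual ℝ (Set.range cs.simple →₀ ℝ)) : ℝ :=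
  letI := Fintype.ofFinite W
  letI := Fintype.ofFinite (Set.range cs.simple)
  ∑ p : W × Set.range cs.simple,
    f (geomRep cs p.1 (sroot _ p.2)) * g (geomRep cs p.1 (sroot _ p.2))

theorem dualPairing_comp [Finite W] (cs : CoxeterSystem M W)
    (f g : Module.Dual ℝ (Set.range cs.simple →₀ ℝ)) (w : W) :
    dualPairing cs (f ∘ₗ geomRep cs w) (g ∘ₗ geomRep cs w) = dualPairing cs f g := by
  let _ := Fintype.ofFinite W
  let _ := Fintype.ofFinite (Set.range cs.simple)
  refine Fintype.sum_equiv ((Equiv.mulLeft w).prodCongr (Equiv.refl _)) _ _ fun p => ?_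
  simp

theorem dualPairing_sub_smul_left [Finite W] (cs : CoxeterSystem M W)
    (f g k : Module.Dual ℝ (Set.range cs.simple →₀ ℝ)) (a : ℝ) :
    dualPairing cs (f - a • g) k = dualPairing cs f k - a * dualPairing cs g k := by
  simp only [dualPairing, Finset.mul_sum, ← Finset.sum_sub_distrib]
  refine Finset.sum_congr rfl fun p _ => ?_
  simp only [LinearMap.sub_apply, LinearMap.smul_apply, smul_eq_mul]
  ring

theorem dualPairing_comm [Finite W] (cs : CoxeterSystem M W)
    (f g : Module.Dual ℝ (Set.range cs.simple →₀ ℝ)) :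
    dualPairing cs f g = dualPairing cs g f :=
  Finset.sum_congr rfl fun _ _ => mul_comm _ _

theorem dualPairing_self_pos [Finite W] (cs : CoxeterSystem M W)
    {f : Module.Dual ℝ (Set.range cs.simple →₀ ℝ)} {i : B} (h : f (sroot _ (sgen cs i)) ≠ 0) :
    0 < dualPairing cs f f := by
  let _ := Fintype.ofFinite W
  let _ := Fintype.ofFinite (Set.range cs.simple)
  refine Finset.sum_pos' (fun _ _ => mul_self_nonneg _) ⟨(1, sgen cs i), Finset.mem_univ _, ?_⟩
  rw [geomRep_one_apply]
  exact mul_self_pos.2 h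

/-- Every functional is conjugate to a dominant one. -/
theorem exists_isDominant_comp_geomRep [Finite W] (cs : CoxeterSystem M W)
    (v : Module.Dual ℝ (Set.range cs.simple →₀ ℝ)) :
    ∃ w, IsDominant cs (v ∘ₗ geomRep cs w) := by
  set d : Module.Dual ℝ (Set.range cs.simple →₀ ℝ) := Finsupp.linearCombination ℝ fun _ => 1
    with hd
  obtain ⟨w, hw⟩ := Finite.exists_max fun w => dualPairing cs (v ∘ₗ geomRep cs w) d
  refine ⟨w, fun i => ?_⟩
  by_contra! hneg
  have h1 := hw (w * cs.simple i)
  rw [comp_geomRep_mul, comp_geomRep_simple, dualPairing_sub_smul_left] at h1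
  have hdi : d (sroot _ (sgen cs i)) = 1 := by simp [hd]
  have hself : (coroot _ (sgen cs i)) (sroot _ (sgen cs i)) = 2 := coroot_sgen_self cs i
  have h2 := dualPairing_comp cs (coroot _ (sgen cs i)) d (cs.simple i)
  rw [comp_geomRep_simple, comp_geomRep_simple, hdi, hself, dualPairing_sub_smul_left,
    dualPairing_comm, dualPairing_sub_smul_left, dualPairing_comm cs d] at h2
  have h3 : 0 < dualPairing cs (coroot _ (sgen cs i)) (coroot _ (sgen cs i)) :=
    dualPairing_self_pos cs (i := i) (by rw [hself]; norm_num)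
  nlinarith

/-! ### The twisted action on roots -/

theorem SimpleOnto.mem_range_iff {cs : CoxeterSystem M W} {θ : W ≃* W} (hθS : SimpleOnto cs θ)
    (w : W) : w ∈ Set.range cs.simple ↔ θ w ∈ Set.range cs.simple := by
  rw [← hθS, θ.injective.mem_set_image, hθS]

/-- The permutation of the simple reflections induced by `θ`. -/
def simplePerm {cs : CoxeterSystem M W} {θ : W ≃* W} (hθS : SimpleOnto cs θ) :
    Equiv.Perm (Set.range cs.simple) :=
  θ.toEquiv.subtypeEquiv hθS.mem_range_iff

/-- The automorphism of the root space induced by `θ`. -/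
def diagramAut {cs : CoxeterSystem M W} {θ : W ≃* W} (hθS : SimpleOnto cs θ) :
    (Set.range cs.simple →₀ ℝ) ≃ₗ[ℝ] (Set.range cs.simple →₀ ℝ) :=
  Finsupp.domLCongr (simplePerm hθS)

section Twisted

variable {cs : CoxeterSystem M W} {θ : W ≃* W} (hθS : SimpleOnto cs θ)

theorem diagramAut_sroot (s : Set.range cs.simple) :
    diagramAut hθS (sroot _ s) = sroot _ (simplePerm hθS s) :=
  Finsupp.domLCongr_single _ _ _

theorem diagramAut_symm_nonneg {y : Set.range cs.simple →₀ ℝ} (hy : 0 ≤ y) :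
    0 ≤ (diagramAut hθS).symm y := fun s => by
  change 0 ≤ y _
  exact hy _

theorem diagramAut_symm_nonpos {y : Set.range cs.simple →₀ ℝ} (hy : y ≤ 0) :
    (diagramAut hθS).symm y ≤ 0 := by
  have := diagramAut_symm_nonneg hθS (neg_nonneg.2 hy)
  rwa [map_neg, neg_nonneg] at this

theorem coroot_diagramAut (s : Set.range cs.simple) (y : Set.range cs.simple →₀ ℝ) :
    coroot _ (simplePerm hθS s) (diagramAut hθS y) = coroot _ s y := by
  suffices h : coroot _ (simplePerm hθS s) ∘ₗ (diagramAut hθS).toLinearMap = coroot _ s from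
    LinearMap.congr_fun h y
  ext t
  have h1 : ((simplePerm hθS s : W) * simplePerm hθS t) = θ ((s : W) * t) := (map_mul θ _ _).symm
  simp only [LinearMap.comp_apply, Finsupp.lsingle_apply, LinearEquiv.coe_coe, diagramAut_sroot,
    coroot_sroot, h1]
  rw [MulEquiv.orderOf_eq]

theorem diagramAut_geomRep [Finite W] (w : W) (y : Set.range cs.simple →₀ ℝ) :
    diagramAut hθS (geomRep cs w y) = geomRep cs (θ w) (diagramAut hθS y) := by
  induction w using cs.simple_induction_left generalizing y with
  | one => simp
  | mul_simple_left w i ih =>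
    obtain ⟨j, hj⟩ := exists_sgen_eq (simplePerm hθS (sgen cs i))
    have hj' : θ (cs.simple i) = cs.simple j := (congrArg Subtype.val hj).symm
    rw [geomRep_mul_apply, map_mul, geomRep_mul_apply, ← ih, hj', geomRep_simple_apply,
      geomRep_simple_apply, hj, coroot_diagramAut, map_sub, map_smul, diagramAut_sroot]

theorem geomRep_inv_apply [Finite W] (w : W) (y : Set.range cs.simple →₀ ℝ) :
    geomRep cs w⁻¹ (geomRep cs w y) = y := by
  rw [← geomRep_mul_apply, inv_mul_cancel, geomRep_one_apply]

theorem geomRep_apply_inv [Finite W] (w : W) (y : Set.range cs.simple →₀ ℝ) :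
    geomRep cs w (geomRep cs w⁻¹ y) = y := by
  rw [← geomRep_mul_apply, mul_inv_cancel, geomRep_one_apply]

/-- The linear automorphism `ρ(x) ∘ θ` of the root space attached to `x`. -/
def twRoot [Finite W] (x : W) : Module.End ℝ (Set.range cs.simple →₀ ℝ) :=
  geomRep cs x ∘ₗ (diagramAut hθS).toLinearMap

/-- The inverse of `twRoot`. -/
def twRootInv [Finite W] (x : W) : Module.End ℝ (Set.range cs.simple →₀ ℝ) :=
  (diagramAut hθS).symm.toLinearMap ∘ₗ geomRep cs x⁻¹

theorem twRoot_apply [Finite W] (x : W) (y : Set.range cs.simple →₀ ℝ) :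
    twRoot hθS x y = geomRep cs x (diagramAut hθS y) := rfl

theorem twRootInv_apply [Finite W] (x : W) (y : Set.range cs.simple →₀ ℝ) :
    twRootInv hθS x y = (diagramAut hθS).symm (geomRep cs x⁻¹ y) := rfl

theorem twRoot_twRootInv [Finite W] (x : W) (y : Set.range cs.simple →₀ ℝ) :
    twRoot hθS x (twRootInv hθS x y) = y := by
  rw [twRoot_apply, twRootInv_apply, LinearEquiv.apply_symm_apply, geomRep_apply_inv]

theorem twRootInv_twRoot [Finite W] (x : W) (y : Set.range cs.simple →₀ ℝ) :
    twRootInv hθS x (twRoot hθS x y) = y := by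
  rw [twRoot_apply, twRootInv_apply, geomRep_inv_apply, LinearEquiv.symm_apply_apply]

theorem twRoot_twConj [Finite W] (w x : W) (y : Set.range cs.simple →₀ ℝ) :
    twRoot hθS (twConj θ w x) (geomRep cs w y) = geomRep cs w (twRoot hθS x y) := by
  rw [twRoot_apply, twRoot_apply, diagramAut_geomRep, ← geomRep_mul_apply, ← geomRep_mul_apply,
    twConj, inv_mul_cancel_right]

theorem twRootInv_twConj [Finite W] (w x : W) (y : Set.range cs.simple →₀ ℝ) :
    twRootInv hθS (twConj θ w x) (geomRep cs w y) = geomRep cs w (twRootInv hθS x y) := by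
  conv_lhs => rw [← twRoot_twRootInv hθS x y, ← twRoot_twConj, twRootInv_twRoot]

theorem twRootInv_sroot [Finite W] (x : W) (i : B) :
    ∃ u j, twRootInv hθS x (sroot _ (sgen cs i)) = geomRep cs u (sroot _ (sgen cs j)) := by
  obtain ⟨j, hj⟩ := exists_sgen_eq ((simplePerm hθS).symm (sgen cs i))
  refine ⟨θ.symm x⁻¹, j, ?_⟩
  rw [twRootInv_apply, LinearEquiv.symm_apply_eq, diagramAut_geomRep, diagramAut_sroot, hj,
    Equiv.apply_symm_apply, MulEquiv.apply_symm_apply]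

/-- The functional `v` lies in the eigenspace of `T + T⁻¹` with eigenvalue `2c`, where `T` is
the transpose of `twRoot`. -/
def IsTwEigen [Finite W] (c : ℝ) (x : W) (v : Module.Dual ℝ (Set.range cs.simple →₀ ℝ)) : Prop :=
  ∀ y, v (twRoot hθS x y) + v (twRootInv hθS x y) = 2 * c * v y

/-- The kernel of `v` meets the set of roots in a subset stable under `twRoot`. -/
def IsTwGeneric [Finite W] (x : W) (v : Module.Dual ℝ (Set.range cs.simple →₀ ℝ)) : Prop :=
  ∀ u i, v (geomRep cs u (sroot _ (sgen cs i))) = 0 →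
    v (twRoot hθS x (geomRep cs u (sroot _ (sgen cs i)))) = 0

variable {hθS}

theorem IsTwEigen.twConj [Finite W] {c : ℝ} {x : W}
    {v : Module.Dual ℝ (Set.range cs.simple →₀ ℝ)} (hv : IsTwEigen hθS c x v) (w : W) :
    IsTwEigen hθS c (twConj θ w x) (v ∘ₗ geomRep cs w⁻¹) := fun y => by
  rw [← geomRep_apply_inv w y, twRoot_twConj, twRootInv_twConj]
  simp only [LinearMap.comp_apply, geomRep_inv_apply]
  exact hv _

theorem IsTwGeneric.twConj [Finite W] {x : W}
    {v : Module.Dual ℝ (Set.range cs.simple →₀ ℝ)} (hv : IsTwGeneric hθS x v) (w : W) :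
    IsTwGeneric hθS (twConj θ w x) (v ∘ₗ geomRep cs w⁻¹) := fun u i h => by
  rw [← geomRep_apply_inv w (geomRep cs u _), twRoot_twConj]
  rw [LinearMap.comp_apply] at h ⊢
  rw [geomRep_inv_apply]
  rw [← geomRep_mul_apply] at h ⊢
  exact hv _ i h

theorem IsDominant.apply_sroot_eq_zero_of_lt [Finite W] {c : ℝ} {x : W}
    {v : Module.Dual ℝ (Set.range cs.simple →₀ ℝ)} (hd : IsDominant cs v)
    (he : IsTwEigen hθS c x v) (hg : IsTwGeneric hθS x v) (hc : 0 ≤ c) {i : B}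
    (hi : cs.length (twConj θ (cs.simple i) x) < cs.length x) : v (sroot _ (sgen cs i)) = 0 := by
  obtain ⟨j, hj⟩ := exists_sgen_eq (simplePerm hθS (sgen cs i))
  have hj' : θ (cs.simple i) = cs.simple j := (congrArg Subtype.val hj).symm
  rw [_root_.twConj, hj', cs.inv_simple] at hi
  have h1 : cs.length (x * cs.simple j) < cs.length x := by
    rcases cs.length_mul_simple x j with h | h
    · rw [mul_assoc] at hi
      rcases cs.length_simple_mul (x * cs.simple j) i with h' | h' <;> omega
    · omega
  have h2 : cs.length (x⁻¹ * cs.simple i) < cs.length x⁻¹ := by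
    rw [← cs.length_inv (x⁻¹ * cs.simple i), mul_inv_rev, inv_inv, cs.inv_simple, cs.length_inv]
    rcases cs.length_simple_mul x i with h | h
    · rcases cs.length_mul_simple (cs.simple i * x) j with h' | h' <;> omega
    · omega
  have h3 : v (twRoot hθS x (sroot _ (sgen cs i))) ≤ 0 := by
    rw [twRoot_apply, diagramAut_sroot, ← hj]
    exact hd.apply_nonpos (geomRep_sroot_nonpos cs x j h1)
  have h4 : v (twRootInv hθS x (sroot _ (sgen cs i))) ≤ 0 :=
    hd.apply_nonpos (diagramAut_symm_nonpos hθS (geomRep_sroot_nonpos cs _ i h2))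
  have h5 : v (twRootInv hθS x (sroot _ (sgen cs i))) = 0 := by
    have := he (sroot _ (sgen cs i))
    have := mul_nonneg hc (hd i)
    linarith
  obtain ⟨u, k, hu⟩ := twRootInv_sroot hθS x i
  rw [hu] at h5
  have := hg u k h5
  rwa [← hu, twRoot_twRootInv] at this

theorem IsDominant.apply_sroot_eq_zero_of_gt [Finite W] {c : ℝ} {x : W}
    {v : Module.Dual ℝ (Set.range cs.simple →₀ ℝ)} (hd : IsDominant cs v)
    (he : IsTwEigen hθS c x v) (hg : IsTwGeneric hθS x v) (hc : c ≤ 0) {i : B}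
    (hi : cs.length x < cs.length (twConj θ (cs.simple i) x)) : v (sroot _ (sgen cs i)) = 0 := by
  obtain ⟨j, hj⟩ := exists_sgen_eq (simplePerm hθS (sgen cs i))
  have hj' : θ (cs.simple i) = cs.simple j := (congrArg Subtype.val hj).symm
  rw [_root_.twConj, hj', cs.inv_simple] at hi
  have h1 : cs.length x < cs.length (x * cs.simple j) := by
    rcases cs.length_mul_simple x j with h | h
    · omega
    · rw [mul_assoc] at hi
      rcases cs.length_simple_mul (x * cs.simple j) i with h' | h' <;> omega
  have h2 : cs.length x⁻¹ < cs.length (x⁻¹ * cs.simple i) := by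
    rw [← cs.length_inv (x⁻¹ * cs.simple i), mul_inv_rev, inv_inv, cs.inv_simple, cs.length_inv]
    rcases cs.length_simple_mul x i with h | h
    · omega
    · rcases cs.length_mul_simple (cs.simple i * x) j with h' | h' <;> omega
  have h3 : 0 ≤ v (twRoot hθS x (sroot _ (sgen cs i))) := by
    rw [twRoot_apply, diagramAut_sroot, ← hj]
    exact hd.apply_nonneg (geomRep_sroot_nonneg cs x j h1)
  have h4 : 0 ≤ v (twRootInv hθS x (sroot _ (sgen cs i))) :=
    hd.apply_nonneg (diagramAut_symm_nonneg hθS (geomRep_sroot_nonneg cs _ i h2))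
  have h5 : v (twRootInv hθS x (sroot _ (sgen cs i))) = 0 := by
    have := he (sroot _ (sgen cs i))
    have := mul_nonneg (neg_nonneg.2 hc) (hd i)
    linarith
  obtain ⟨u, k, hu⟩ := twRootInv_sroot hθS x i
  rw [hu] at h5
  have := hg u k h5
  rwa [← hu, twRoot_twRootInv] at this

/-- The height is `ℓ/2` or `-ℓ/2`, according to the sign of `c`. -/
def IsSignedHeight (cs : CoxeterSystem M W) (h : W → ℚ) (c : ℝ) : Prop :=
  (h = htL cs ∧ 0 ≤ c) ∨ (h = (fun x => -htL cs x) ∧ c ≤ 0)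

theorem IsDominant.apply_sroot_eq_zero [Finite W] {c : ℝ} {h : W → ℚ} (hh : IsSignedHeight cs h c)
    {x : W} {v : Module.Dual ℝ (Set.range cs.simple →₀ ℝ)} (hd : IsDominant cs v)
    (he : IsTwEigen hθS c x v) (hg : IsTwGeneric hθS x v) {i : B}
    (hi : h (twConj θ (cs.simple i) x) < h x) : v (sroot _ (sgen cs i)) = 0 := by
  have key : ∀ a b : ℕ, (a : ℚ) / 2 < b / 2 → a < b := fun a b hab => by
    rw [div_lt_div_iff_of_pos_right two_pos] at hab
    exact_mod_cast hab
  rcases hh with ⟨rfl, hc⟩ | ⟨rfl, hc⟩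
  · exact hd.apply_sroot_eq_zero_of_lt he hg hc (key _ _ hi)
  · exact hd.apply_sroot_eq_zero_of_gt he hg hc (key _ _ (neg_lt_neg_iff.1 hi))

theorem comp_geomRep_inv_eq [Finite W] {v v' : Module.Dual ℝ (Set.range cs.simple →₀ ℝ)} {w : W}
    (h : v ∘ₗ geomRep cs w = v') : v' ∘ₗ geomRep cs w⁻¹ = v := by
  rw [← h, ← comp_geomRep_mul, mul_inv_cancel, comp_geomRep_one]

/-- The stabilizer of a dominant functional moves `x` to the minimal element. -/
theorem IsDominant.exists_twConj_eq [Finite W] {𝒦 : Set W} (hK : IsTwClass θ 𝒦) {c : ℝ}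
    {h : W → ℚ} (hh : IsSignedHeight cs h c) (hqp : IsQPHeight cs θ h 𝒦) {x x₀ : W} (hx : x ∈ 𝒦)
    (hx₀ : x₀ ∈ 𝒦) (hmin : ∀ z ∈ 𝒦, h x₀ ≤ h z) {v : Module.Dual ℝ (Set.range cs.simple →₀ ℝ)}
    (hd : IsDominant cs v) (he : IsTwEigen hθS c x v) (hg : IsTwGeneric hθS x v) :
    ∃ u, v ∘ₗ geomRep cs u = v ∧ twConj θ u x = x₀ := by
  have : Nonempty {u // v ∘ₗ geomRep cs u = v} := ⟨⟨1, comp_geomRep_one cs v⟩⟩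
  obtain ⟨⟨u, hu⟩, humin⟩ :=
    Finite.exists_min fun u : {u // v ∘ₗ geomRep cs u = v} => h (twConj θ u x)
  refine ⟨u, hu, hqp.eq_of_locally_minimal hK (hK.twConj_mem u hx) hx₀ (fun i => ?_) hmin⟩
  by_contra! hlt
  have he' := he.twConj u
  have hg' := hg.twConj u
  rw [comp_geomRep_inv_eq hu] at he' hg'
  have h0 := hd.apply_sroot_eq_zero hh he' hg' hlt
  have h1 : v ∘ₗ geomRep cs (cs.simple i * u) = v := by
    rw [comp_geomRep_mul, comp_geomRep_simple, h0, zero_smul, sub_zero, hu]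
  have h2 := humin ⟨_, h1⟩
  simp only [twConj_mul] at h2
  exact hlt.not_ge h2

/-- A generic eigenvector at the minimal element is conjugate to a dominant one by an element
fixing the minimal element. -/
theorem IsTwEigen.exists_isDominant [Finite W] {𝒦 : Set W} (hK : IsTwClass θ 𝒦) {c : ℝ}
    {h : W → ℚ} (hh : IsSignedHeight cs h c) (hqp : IsQPHeight cs θ h 𝒦) {x₀ : W}
    (hx₀ : x₀ ∈ 𝒦) (hmin : ∀ z ∈ 𝒦, h x₀ ≤ h z) {v : Module.Dual ℝ (Set.range cs.simple →₀ ℝ)}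
    (he : IsTwEigen hθS c x₀ v) (hg : IsTwGeneric hθS x₀ v) :
    ∃ a, _root_.twConj θ a x₀ = x₀ ∧ IsDominant cs (v ∘ₗ geomRep cs a) := by
  obtain ⟨w, hw⟩ := exists_isDominant_comp_geomRep cs v
  have he' := he.twConj w⁻¹
  have hg' := hg.twConj w⁻¹
  rw [inv_inv] at he' hg'
  obtain ⟨u, hu, hux⟩ := hw.exists_twConj_eq hK hh hqp (hK.twConj_mem w⁻¹ hx₀) hx₀ hmin he' hg'
  refine ⟨w * u⁻¹, ?_, ?_⟩
  · conv_lhs => rw [← hux]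
    rw [twConj_mul, twConj_inv_twConj, twConj_twConj_inv]
  · rw [comp_geomRep_mul, comp_geomRep_inv_eq hu]
    exact hw

theorem IsTwEigen.add_smul [Finite W] {c : ℝ} {x : W}
    {v v' : Module.Dual ℝ (Set.range cs.simple →₀ ℝ)} (hv : IsTwEigen hθS c x v)
    (hv' : IsTwEigen hθS c x v') (t : ℝ) : IsTwEigen hθS c x (v + t • v') := fun y => by
  simp only [LinearMap.add_apply, LinearMap.smul_apply, smul_eq_mul]
  linear_combination hv y + t * hv' y

theorem IsTwEigen.smul [Finite W] {c : ℝ} {x : W}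
    {v : Module.Dual ℝ (Set.range cs.simple →₀ ℝ)} (hv : IsTwEigen hθS c x v) (t : ℝ) :
    IsTwEigen hθS c x (t • v) := fun y => by
  simp only [LinearMap.smul_apply, smul_eq_mul]
  linear_combination t * hv y

theorem IsTwEigen.comp_twRoot [Finite W] {c : ℝ} {x : W}
    {v : Module.Dual ℝ (Set.range cs.simple →₀ ℝ)} (hv : IsTwEigen hθS c x v) :
    IsTwEigen hθS c x (v ∘ₗ twRoot hθS x) := fun y => by
  simp only [LinearMap.comp_apply]
  rw [← hv (twRoot hθS x y), twRoot_twRootInv, twRootInv_twRoot]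

theorem IsTwEigen.apply_twRoot_twRoot [Finite W] {c : ℝ} {x : W}
    {v : Module.Dual ℝ (Set.range cs.simple →₀ ℝ)} (hv : IsTwEigen hθS c x v)
    (y : Set.range cs.simple →₀ ℝ) :
    v (twRoot hθS x (twRoot hθS x y)) = 2 * c * v (twRoot hθS x y) - v y := by
  rw [← hv (twRoot hθS x y), twRootInv_twRoot, add_sub_cancel_right]

open Filter Topology in
/-- Small multiples of `v ∘ twRoot` perturb an eigenvector `v` into a generic one. -/
theorem IsTwEigen.eventually_isTwGeneric [Finite W] {c : ℝ} {x : W}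
    {v : Module.Dual ℝ (Set.range cs.simple →₀ ℝ)} (hv : IsTwEigen hθS c x v) :
    ∀ᶠ t in 𝓝[≠] (0 : ℝ), IsTwGeneric hθS x (v + t • v ∘ₗ twRoot hθS x) := by
  have key : ∀ a b : ℝ, ∀ᶠ t in 𝓝[≠] (0 : ℝ), a + t * b = 0 → a = 0 ∧ b = 0 := fun a b => by
    by_cases ha : a = 0
    · filter_upwards [self_mem_nhdsWithin] with t ht h
      rw [ha, zero_add] at h
      exact ⟨ha, (mul_eq_zero.1 h).resolve_left ht⟩
    · have hcont : ContinuousAt (fun t => a + t * b) 0 := by fun_prop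
      have := hcont.eventually_ne (y := 0) (by simpa using ha)
      filter_upwards [nhdsWithin_le_nhds this] with t ht h
      exact absurd h ht
  have hall : ∀ᶠ t in 𝓝[≠] (0 : ℝ), ∀ p : W × Set.range cs.simple,
      v (geomRep cs p.1 (sroot _ p.2)) + t * v (twRoot hθS x (geomRep cs p.1 (sroot _ p.2))) = 0 →
      v (geomRep cs p.1 (sroot _ p.2)) = 0 ∧
        v (twRoot hθS x (geomRep cs p.1 (sroot _ p.2))) = 0 :=
    eventually_all.2 fun p => key _ _
  filter_upwards [hall] with t ht u i h
  obtain ⟨h1, h2⟩ := ht (u, sgen cs i) h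
  simp only [LinearMap.add_apply, LinearMap.smul_apply, LinearMap.comp_apply,
    hv.apply_twRoot_twRoot, h1, h2]
  simp

open Filter Topology in
theorem IsTwEigen.exists_frequently_isDominant [Finite W] {𝒦 : Set W} (hK : IsTwClass θ 𝒦) {c : ℝ}
    {h : W → ℚ} (hh : IsSignedHeight cs h c) (hqp : IsQPHeight cs θ h 𝒦) {x₀ : W}
    (hx₀ : x₀ ∈ 𝒦) (hmin : ∀ z ∈ 𝒦, h x₀ ≤ h z) {v : Module.Dual ℝ (Set.range cs.simple →₀ ℝ)}
    (hv : IsTwEigen hθS c x₀ v) (F : Filter ℝ) [F.NeBot] (hF : F ≤ 𝓝[≠] 0) :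
    ∃ a, _root_.twConj θ a x₀ = x₀ ∧ IsDominant cs (v ∘ₗ geomRep cs a) ∧
      ∃ᶠ t in F, IsDominant cs ((v + t • v ∘ₗ twRoot hθS x₀) ∘ₗ geomRep cs a) := by
  have h1 : ∀ᶠ t in F, ∃ a, _root_.twConj θ a x₀ = x₀ ∧
      IsDominant cs ((v + t • v ∘ₗ twRoot hθS x₀) ∘ₗ geomRep cs a) := by
    filter_upwards [hF hv.eventually_isTwGeneric] with t ht
    exact (hv.add_smul hv.comp_twRoot t).exists_isDominant hK hh hqp hx₀ hmin ht
  obtain ⟨a, ha⟩ : ∃ a, ∃ᶠ t in F, _root_.twConj θ a x₀ = x₀ ∧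
      IsDominant cs ((v + t • v ∘ₗ twRoot hθS x₀) ∘ₗ geomRep cs a) := by
    by_contra hcon
    rw [not_exists] at hcon
    have h2 := eventually_all.2 fun a => not_frequently.1 (hcon a)
    obtain ⟨t, ⟨a, hta⟩, ht⟩ := (h1.and h2).exists
    exact ht a hta
  obtain ⟨_, hax, -⟩ := ha.exists
  refine ⟨a, hax, fun i => ?_, ha.mono fun t ht => ht.2⟩
  by_contra! hneg
  have hcont : ContinuousAt (fun t => v (geomRep cs a (sroot _ (sgen cs i))) +
      t * v (twRoot hθS x₀ (geomRep cs a (sroot _ (sgen cs i))))) 0 := by fun_prop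
  have h3 := hcont.eventually_lt (continuousAt_const (y := (0 : ℝ))) (by simpa using hneg)
  obtain ⟨t, ht, ht'⟩ := (ha.and_eventually (hF (nhdsWithin_le_nhds h3))).exists
  exact (ht.2 i).not_gt ht'

open Filter Topology in
/-- A quasiparabolic class has no eigenvector at its minimal element with `-1 < c < 1`. -/
theorem IsTwEigen.eq_zero [Finite W] {𝒦 : Set W} (hK : IsTwClass θ 𝒦) {c : ℝ}
    {h : W → ℚ} (hh : IsSignedHeight cs h c) (hqp : IsQPHeight cs θ h 𝒦) {x₀ : W}
    (hx₀ : x₀ ∈ 𝒦) (hmin : ∀ z ∈ 𝒦, h x₀ ≤ h z) (hc : c ^ 2 < 1)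
    {v : Module.Dual ℝ (Set.range cs.simple →₀ ℝ)} (hv : IsTwEigen hθS c x₀ v) : v = 0 := by
  by_contra hv0
  obtain ⟨i, hi⟩ : ∃ i, v (sroot _ (sgen cs i)) ≠ 0 := by
    by_contra! hall
    refine hv0 (Finsupp.lhom_ext' fun s => LinearMap.ext_ring ?_)
    obtain ⟨i, rfl⟩ := exists_sgen_eq s
    exact hall i
  obtain ⟨l, hl, hli, hlτ⟩ : ∃ l, IsTwEigen hθS c x₀ l ∧ l (sroot _ (sgen cs i)) = 0 ∧
      l (twRoot hθS x₀ (sroot _ (sgen cs i))) ≠ 0 := by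
    set a := v (sroot _ (sgen cs i)) with ha
    set b := v (twRoot hθS x₀ (sroot _ (sgen cs i))) with hb
    refine ⟨a • v ∘ₗ twRoot hθS x₀ + (-b) • v, (hv.comp_twRoot.smul a).add_smul hv _, ?_, ?_⟩
    · simp only [LinearMap.add_apply, LinearMap.smul_apply, LinearMap.comp_apply, smul_eq_mul,
        ← ha, ← hb]
      ring
    · simp only [LinearMap.add_apply, LinearMap.smul_apply, LinearMap.comp_apply, smul_eq_mul,
        hv.apply_twRoot_twRoot, ← ha, ← hb]
      have := mul_pos (sub_pos.2 hc) (pow_two_pos_of_ne_zero hi)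
      nlinarith [sq_nonneg (b - c * a)]
  obtain ⟨a, hax, had, ha⟩ := hl.exists_frequently_isDominant hK hh hqp hx₀ hmin (𝓝[>] 0)
    (nhdsWithin_mono _ fun _ h => ne_of_gt h)
  obtain ⟨b, hbx, hbd, hb⟩ := hl.exists_frequently_isDominant hK hh hqp hx₀ hmin (𝓝[<] 0)
    (nhdsWithin_mono _ fun _ h => ne_of_lt h)
  obtain ⟨t, htd, ht⟩ := (ha.and_eventually self_mem_nhdsWithin).exists
  obtain ⟨t', htd', ht'⟩ := (hb.and_eventually self_mem_nhdsWithin).exists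
  have hab : l ∘ₗ geomRep cs b = l ∘ₗ geomRep cs a := by
    have h1 : (l ∘ₗ geomRep cs a) ∘ₗ geomRep cs (a⁻¹ * b) = l ∘ₗ geomRep cs b := by
      rw [← comp_geomRep_mul, mul_inv_cancel_left]
    rw [← h1]
    exact had.comp_geomRep_eq (h1 ▸ hbd)
  have hab' : ∀ y, l (geomRep cs b y) = l (geomRep cs a y) := LinearMap.congr_fun hab
  have hcomm : ∀ g, _root_.twConj θ g x₀ = x₀ → ∀ y,
      twRoot hθS x₀ (geomRep cs g y) = geomRep cs g (twRoot hθS x₀ y) := fun g hg y => by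
    conv_lhs => rw [← hg, twRoot_twConj]
  set y := geomRep cs a⁻¹ (sroot _ (sgen cs i)) with hy
  have hya : geomRep cs a y = sroot _ (sgen cs i) := geomRep_apply_inv a _
  have e1 : ((l + t • l ∘ₗ twRoot hθS x₀) ∘ₗ geomRep cs a) y =
      t * l (twRoot hθS x₀ (sroot _ (sgen cs i))) := by
    simp [hya, hli]
  have e2 : ((l + t' • l ∘ₗ twRoot hθS x₀) ∘ₗ geomRep cs b) y =
      t' * l (twRoot hθS x₀ (sroot _ (sgen cs i))) := by
    simp only [LinearMap.add_apply, LinearMap.smul_apply, LinearMap.comp_apply, smul_eq_mul,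
      hcomm b hbx, hab']
    rw [← hcomm a hax, hya, hli, zero_add]
  rcases cs.length_mul_simple a⁻¹ i with hlen | hlen
  · have hy0 := geomRep_sroot_nonneg cs a⁻¹ i (by omega)
    have h1 := htd.apply_nonneg hy0
    have h2 := htd'.apply_nonneg hy0
    rw [← hy, e1] at h1
    rw [← hy, e2] at h2
    exact hlτ (le_antisymm (nonpos_of_mul_nonneg_right h2 ht') (nonneg_of_mul_nonneg_right h1 ht))
  · have hy0 := geomRep_sroot_nonpos cs a⁻¹ i (by omega)
    have h1 := htd.apply_nonpos hy0
    have h2 := htd'.apply_nonpos hy0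
    rw [← hy, e1] at h1
    rw [← hy, e2] at h2
    exact hlτ (le_antisymm (by nlinarith) (by nlinarith))

/-- A linear operator of finite order which is not an involution has a functional in an eigenspace
of its real part with eigenvalue strictly between `-1` and `1`. -/
theorem exists_dual_eigenvector {V : Type*} [AddCommGroup V] [Module ℝ V] [Module.Finite ℝ V]
    {τ τ' : Module.End ℝ V} (hτ : ∀ y, τ (τ' y) = y) {n : ℕ} (hn : n ≠ 0) (hpow : τ ^ n = 1)
    (hne : τ ^ 2 ≠ 1) :
    ∃ c : ℝ, c ^ 2 < 1 ∧ ∃ v : Module.Dual ℝ V, v ≠ 0 ∧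
      ∀ y, v (τ y) + v (τ' y) = 2 * c * v y := by
  let T : Module.End ℂ (V →ₗ[ℝ] ℂ) :=
    { toFun := fun φ => φ ∘ₗ τ, map_add' := fun _ _ => rfl, map_smul' := fun _ _ => rfl }
  have hT : ∀ k φ, (T ^ k) φ = φ ∘ₗ (τ ^ k) := fun k φ => by
    induction k with
    | zero => rfl
    | succ k ih =>
      rw [pow_succ', Module.End.mul_apply, ih, pow_succ]
      rfl
  have hTn : T ^ n = 1 := LinearMap.ext fun φ => by rw [hT, hpow]; rfl
  set g := T ^ 2 - 1 with hgdef
  have hg : g ≠ 0 := fun h0 => by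
    refine hne (LinearMap.ext fun y => sub_eq_zero.1 ?_)
    refine (Module.forall_dual_apply_eq_zero_iff ℝ _).1 fun f => ?_
    have h1 := LinearMap.congr_fun (LinearMap.congr_fun h0 (Algebra.linearMap ℝ ℂ ∘ₗ f)) y
    rw [hgdef, LinearMap.sub_apply, hT] at h1
    simpa [← Complex.ofReal_sub, -Complex.ofReal_pow] using h1
  have hcomm : ∀ u, T (g u) = g (T u) := fun u =>
    LinearMap.congr_fun (((Commute.refl T).pow_right 2).sub_right (Commute.one_right T)).eq u
  have hinv : ∀ w ∈ LinearMap.range g, T w ∈ LinearMap.range g := by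
    rintro _ ⟨u, rfl⟩
    exact ⟨T u, (hcomm u).symm⟩
  have : Nontrivial (LinearMap.range g) :=
    Submodule.nontrivial_iff_ne_bot.2 (mt LinearMap.range_eq_bot.1 hg)
  obtain ⟨ζ, hζ⟩ := Module.End.exists_eigenvalue (T.restrict hinv)
  obtain ⟨⟨w, u, huw⟩, hw, hw0⟩ := hζ.exists_hasEigenvector
  rw [Module.End.mem_eigenspace_iff] at hw
  have hw : T w = ζ • w := congrArg Subtype.val hw
  have hw0 : w ≠ 0 := fun h => hw0 (Subtype.ext h)
  have hwk : ∀ k, (T ^ k) w = ζ ^ k • w := fun k => by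
    induction k with
    | zero => simp
    | succ k ih => rw [pow_succ', Module.End.mul_apply, ih, map_smul, hw, smul_smul, pow_succ]
  have hζn : ζ ^ n = 1 := by
    have := hwk n
    rw [hTn, Module.End.one_apply] at this
    exact smul_left_injective ℂ hw0 (show ζ ^ n • w = (1 : ℂ) • w by rw [← this, one_smul])
  have hζ2 : ζ ^ 2 ≠ 1 := fun h2 => by
    have hu : (T ^ 2) u = u + w := by rw [← huw, hgdef]; simp
    have huk : ∀ k : ℕ, ((T ^ 2) ^ k) u = u + k • w := fun k => by
      induction k with
      | zero => simp
      | succ k ih =>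
        rw [pow_succ', Module.End.mul_apply, ih, map_add, map_nsmul, hu, hwk, h2, one_smul,
          add_smul, one_smul]
        abel
    have h3 := huk n
    rw [← pow_mul, mul_comm, pow_mul, hTn, one_pow, Module.End.one_apply, left_eq_add] at h3
    exact hw0 ((smul_eq_zero.1 h3).resolve_left hn)
  have hnorm : ζ.re * ζ.re + ζ.im * ζ.im = 1 := by
    rw [← Complex.normSq_apply, Complex.normSq_eq_norm_sq,
      Complex.norm_eq_one_of_pow_eq_one hζn hn, one_pow]
  have hsum : ∀ y, w (τ y) + w (τ' y) = (2 * ζ.re : ℝ) * w y := fun y => by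
    have h1 : ∀ y, w (τ y) = ζ * w y := LinearMap.congr_fun hw
    have h2 := h1 (τ' y)
    rw [hτ] at h2
    rw [h1, h2]
    have h3 : (starRingEnd ℂ) ζ * ζ = 1 := by
      rw [mul_comm, Complex.mul_conj, Complex.normSq_apply, hnorm, Complex.ofReal_one]
    rw [← Complex.add_conj]
    linear_combination -w (τ' y) * h3
  refine ⟨ζ.re, ?_, ?_⟩
  · have : ζ.im ≠ 0 := fun h0 => hζ2 <| by
      rw [h0] at hnorm
      exact Complex.ext (by simp [pow_two, h0]; linarith) (by simp [pow_two, h0])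
    nlinarith [pow_two_pos_of_ne_zero this]
  · by_cases hre : Complex.reLm ∘ₗ w = 0
    · refine ⟨Complex.imLm ∘ₗ w, fun him => hw0 (LinearMap.ext fun y => Complex.ext ?_ ?_),
        fun y => ?_⟩
      · exact LinearMap.congr_fun hre y
      · exact LinearMap.congr_fun him y
      · simpa using congrArg Complex.im (hsum y)
    · exact ⟨_, hre, fun y => by simpa using congrArg Complex.re (hsum y)⟩

theorem exists_twRoot_pow_eq_one [Finite W] (x : W) : ∃ n, n ≠ 0 ∧ twRoot hθS x ^ n = 1 := by
  set D : Module.End ℝ (Set.range cs.simple →₀ ℝ) := (diagramAut hθS).toLinearMap with hD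
  have hDk : ∀ k s, (D ^ k) (sroot _ s) = sroot _ ((simplePerm hθS ^ k) s) := fun k s => by
    induction k with
    | zero => rfl
    | succ k ih =>
      rw [pow_succ', Module.End.mul_apply, ih, pow_succ', Equiv.Perm.mul_apply]
      exact diagramAut_sroot hθS _
  have hDN : D ^ orderOf (simplePerm hθS) = 1 :=
    Finsupp.lhom_ext' fun s => LinearMap.ext_ring <| by
      change (D ^ _) (sroot _ s) = sroot _ s
      rw [hDk, pow_orderOf_eq_one]
      rfl
  have hk : ∀ k, ∃ y, twRoot hθS x ^ k = geomRep cs y * D ^ k := fun k => by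
    induction k with
    | zero => exact ⟨1, by simp⟩
    | succ k ih =>
      obtain ⟨y, hy⟩ := ih
      refine ⟨x * θ y, LinearMap.ext fun z => ?_⟩
      rw [pow_succ', hy, pow_succ']
      simp only [Module.End.mul_apply]
      rw [twRoot_apply, diagramAut_geomRep, geomRep_mul_apply]
      rfl
  obtain ⟨y, hy⟩ := hk (orderOf (simplePerm hθS))
  refine ⟨orderOf (simplePerm hθS) * orderOf y,
    mul_ne_zero (orderOf_pos _).ne' (orderOf_pos _).ne', ?_⟩
  rw [pow_mul, hy, hDN, mul_one, ← map_pow, pow_orderOf_eq_one, map_one]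

/-- On a quasiparabolic class, every `twRoot` is an involution. -/
theorem IsQPHeight.twRoot_sq [Finite W] {𝒦 : Set W} (hK : IsTwClass θ 𝒦)
    (hqp : IsQPHeight cs θ (htL cs) 𝒦) {x : W} (hx : x ∈ 𝒦) : twRoot hθS x ^ 2 = 1 := by
  by_contra hne
  obtain ⟨n, hn, hpow⟩ := exists_twRoot_pow_eq_one (hθS := hθS) x
  obtain ⟨c, hc, v, hv0, hv⟩ := exists_dual_eigenvector (twRoot_twRootInv hθS x) hn hpow hne
  obtain ⟨h, hh, hqp'⟩ : ∃ h, IsSignedHeight cs h c ∧ IsQPHeight cs θ h 𝒦 := by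
    rcases le_total 0 c with h0 | h0
    · exact ⟨_, Or.inl ⟨rfl, h0⟩, hqp⟩
    · exact ⟨_, Or.inr ⟨rfl, h0⟩, hqp.neg hK⟩
  have : Nonempty 𝒦 := ⟨⟨x, hx⟩⟩
  obtain ⟨⟨x₀, hx₀⟩, hmin⟩ := Finite.exists_min fun z : 𝒦 => h z
  obtain ⟨w, rfl⟩ := hK.exists_twConj hx hx₀
  have h0 := (IsTwEigen.twConj hv w).eq_zero hK hh hqp' hx₀ (fun z hz => hmin ⟨z, hz⟩) hc
  refine hv0 (LinearMap.ext fun y => ?_)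
  rw [← geomRep_inv_apply w y]
  exact LinearMap.congr_fun h0 _

theorem map_eq_inv_of_twRoot_sq [Finite W] {x : W} (hx : twRoot hθS x ^ 2 = 1) : θ x = x⁻¹ := by
  rw [eq_inv_iff_mul_eq_one, ← mul_eq_one_comm]
  by_contra hne
  obtain ⟨i, hi⟩ := cs.exists_rightDescent_of_ne_one hne
  have h1 := geomRep_sroot_nonpos cs _ i hi
  set s := (simplePerm hθS).symm ((simplePerm hθS).symm (sgen cs i)) with hs
  have h2 := LinearMap.congr_fun hx (sroot _ s)
  rw [pow_two, Module.End.mul_apply, twRoot_apply, twRoot_apply, diagramAut_sroot,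
    diagramAut_geomRep, diagramAut_sroot, hs, Equiv.apply_symm_apply, Equiv.apply_symm_apply,
    ← geomRep_mul_apply, Module.End.one_apply] at h2
  rw [h2] at h1
  have := h1 s
  rw [hs, Finsupp.single_eq_same] at this
  exact absurd this (by norm_num)

end Twisted

/-- If `W` is finite, then every quasiparabolic `θ`-twisted conjugacy class
consists of twisted involutions: `θ² = id` and `θ(x) = x⁻¹` for all `x ∈ 𝒦`. -/
theorem stmt16 [Finite W] (cs : CoxeterSystem M W) (θ : W ≃* W) (hθS : SimpleOnto cs θ)
    (𝒦 : Set W) (hK : IsTwClass θ 𝒦) (hqp : IsQPClass cs θ 𝒦) :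
    (∀ w : W, θ (θ w) = w) ∧ ∀ x ∈ 𝒦, θ x = x⁻¹ := by
  have key : ∀ x ∈ 𝒦, θ x = x⁻¹ := fun x hx =>
    map_eq_inv_of_twRoot_sq (hθS := hθS) (IsQPHeight.twRoot_sq hK hqp hx)
  refine ⟨fun w => ?_, key⟩
  obtain ⟨x, hx⟩ : 𝒦.Nonempty := by
    obtain ⟨x₀, rfl⟩ := hK
    exact Set.range_nonempty _
  have h := key _ (hK.twConj_mem w hx)
  simp only [twConj, map_mul, map_inv, key x hx, mul_inv_rev, inv_inv, mul_assoc,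
    mul_right_inj] at h
  exact inv_injective h

end
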